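/- arXiv:1811.05428 — 2 statements merged into one kernel-verified Lean document; each statement's English description precedes it below -/
import Mathlib

section
/- Let γ ∈ ℝ and let (bₙ)_{n≥0} be a sequence of positive real numbers for which there exist constants c₁, c₂ > 0 with c₁(n+1)^γ ≤ bₙ ≤ c₂(n+1)^γ for all n ≥ 0. Then the multiplication operator M_z on H(b) is Möbius bounded — i.e., there exists c > 0 such that for every θ ∈ [0,2π), a ∈ 𝔻 and f ∈ H(b), the product φ_{θ,a}·f belongs to H(b) with ‖φ_{θ,a} f‖_{H(b)} ≤ c ‖f‖_{H(b)} — if and only if γ > −1. -/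
open Metric

/-- The Möbius transformation `φ_{θ,a}(z) = e^{iθ} (z − a)/(1 − ā z)`. -/
noncomputable def mobius (θ : ℝ) (a z : ℂ) : ℂ :=
  Complex.exp (θ * Complex.I) * (z - a) / (1 - (starRingEnd ℂ) a * z)

/-- The multiplication operator `M_z` on the weighted Hardy space `H(b)` (with
`‖Σ αₙ zⁿ‖² = Σ |αₙ|²/bₙ`) is Möbius bounded: there is a single constant `c > 0` bounding the
norm of the multiplication operator `M_{φ_{θ,a}}` on `H(b)` for every `φ_{θ,a} ∈ Möb`. -/
def MobiusBounded (b : ℕ → ℝ) : Prop :=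
  ∃ c : ℝ, 0 < c ∧ ∀ θ ∈ Set.Ico (0 : ℝ) (2 * Real.pi), ∀ a ∈ ball (0 : ℂ) 1,
    ∀ (f : ℂ → ℂ) (α : ℕ → ℂ),
      (∀ z ∈ ball (0 : ℂ) 1, HasSum (fun n => α n * z ^ n) (f z)) →
      Summable (fun n => ‖α n‖ ^ 2 / b n) →
      ∃ β : ℕ → ℂ,
        (∀ z ∈ ball (0 : ℂ) 1, HasSum (fun n => β n * z ^ n) (mobius θ a z * f z)) ∧
        Summable (fun n => ‖β n‖ ^ 2 / b n) ∧
        ∑' n, ‖β n‖ ^ 2 / b n ≤ c ^ 2 * ∑' n, ‖α n‖ ^ 2 / b n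

/-- The Taylor coefficients of `φ_{θ,a}` at the origin. -/
noncomputable def mobiusCoeff (θ : ℝ) (a : ℂ) : ℕ → ℂ
  | 0 => Complex.exp (θ * Complex.I) * -a
  | j + 1 => Complex.exp (θ * Complex.I) * (((1 - ‖a‖ ^ 2 : ℝ) : ℂ) * (starRingEnd ℂ) a ^ j)

lemma hasSum_mobius (θ : ℝ) {a z : ℂ} (ha : ‖a‖ < 1) (hz : ‖z‖ < 1) :
    HasSum (fun n => mobiusCoeff θ a n * z ^ n) (mobius θ a z) := by
  have hlt : ‖(starRingEnd ℂ) a * z‖ < 1 := by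
    rw [norm_mul, RCLike.norm_conj]
    exact mul_lt_one_of_nonneg_of_lt_one_left (norm_nonneg _) ha hz.le
  have hne : 1 - (starRingEnd ℂ) a * z ≠ 0 := by
    intro h
    rw [← sub_eq_zero.mp h, norm_one] at hlt
    exact lt_irrefl _ hlt
  rw [← hasSum_nat_add_iff' 1]
  have hgeom := (hasSum_geometric_of_norm_lt_one hlt).mul_left
    (Complex.exp (θ * Complex.I) * ((1 - ‖a‖ ^ 2 : ℝ) : ℂ) * z)
  convert hgeom using 1
  · rfl
  · funext n
    simp only [mobiusCoeff]
    ring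
  · have hnorm : (((1 - ‖a‖ ^ 2 : ℝ)) : ℂ) = 1 - a * (starRingEnd ℂ) a := by
      rw [Complex.mul_conj']
      push_cast
      ring
    rw [hnorm]
    simp only [mobius, Finset.range_one, Finset.sum_singleton, mobiusCoeff, pow_zero, mul_one]
    rw [eq_mul_inv_iff_mul_eq₀ hne, sub_mul, div_mul_cancel₀ _ hne]
    ring

lemma norm_mobiusCoeff_zero (θ : ℝ) (a : ℂ) : ‖mobiusCoeff θ a 0‖ = ‖a‖ := by
  simp [mobiusCoeff, Complex.norm_exp_ofReal_mul_I]

lemma norm_mobiusCoeff_succ (θ : ℝ) {a : ℂ} (ha : ‖a‖ < 1) (j : ℕ) :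
    ‖mobiusCoeff θ a (j + 1)‖ = (1 - ‖a‖ ^ 2) * ‖a‖ ^ j := by
  have h : 0 ≤ 1 - ‖a‖ ^ 2 := by nlinarith [norm_nonneg a]
  simp only [mobiusCoeff, norm_mul, Complex.norm_exp_ofReal_mul_I, norm_pow, RCLike.norm_conj,
    Complex.norm_real, Real.norm_of_nonneg h, one_mul]

lemma hasSum_norm_mobiusCoeff (θ : ℝ) {a : ℂ} (ha : ‖a‖ < 1) :
    HasSum (fun n => ‖mobiusCoeff θ a n‖) (1 + 2 * ‖a‖) := by
  rw [← hasSum_nat_add_iff' 1]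
  simp only [norm_mobiusCoeff_succ θ ha, Finset.range_one, Finset.sum_singleton,
    norm_mobiusCoeff_zero]
  convert (hasSum_geometric_of_lt_one (norm_nonneg a) ha).mul_left (1 - ‖a‖ ^ 2) using 1
  · rfl
  · have : 1 - ‖a‖ ≠ 0 := by linarith
    rw [eq_mul_inv_iff_mul_eq₀ this]
    ring

lemma hasSum_mobius_mul (θ : ℝ) {a z w : ℂ} {α : ℕ → ℂ} (ha : ‖a‖ < 1) (hz : ‖z‖ < 1)
    (hα : HasSum (fun n => α n * z ^ n) w) :
    HasSum (fun n => (∑ k ∈ Finset.range (n + 1), α k * mobiusCoeff θ a (n - k)) * z ^ n)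
      (mobius θ a z * w) := by
  have hφ := hasSum_mobius θ ha hz
  have h := hasSum_sum_range_mul_of_summable_norm hα.summable.norm hφ.summable.norm
  rw [hα.tsum_eq, hφ.tsum_eq, mul_comm] at h
  refine h.congr_fun ?_
  intro n
  rw [Finset.sum_mul]
  refine Finset.sum_congr rfl fun k hk => ?_
  rw [← Nat.add_sub_cancel' (Finset.mem_range_succ_iff.mp hk), pow_add]
  simp only [Nat.add_sub_cancel_left]
  ring

lemma coeff_unique {g : ℂ → ℂ} {β β' : ℕ → ℂ}
    (h : ∀ z ∈ ball (0 : ℂ) 1, HasSum (fun n => β n * z ^ n) (g z))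
    (h' : ∀ z ∈ ball (0 : ℂ) 1, HasSum (fun n => β' n * z ^ n) (g z)) : β = β' := by
  have key : ∀ δ : ℕ → ℂ, (∀ z ∈ ball (0 : ℂ) 1, HasSum (fun n => δ n * z ^ n) (g z)) →
      HasFPowerSeriesAt g (FormalMultilinearSeries.ofScalars ℂ δ) 0 := by
    intro δ hδ
    rw [hasFPowerSeriesAt_iff]
    filter_upwards [ball_mem_nhds (0 : ℂ) one_pos] with z hz
    simpa [FormalMultilinearSeries.coeff_ofScalars, mul_comm] using hδ z hz
  funext n
  have := congrArg (fun p => FormalMultilinearSeries.coeff p n)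
    ((key β h).eq_formalMultilinearSeries (key β' h'))
  simpa [FormalMultilinearSeries.coeff_ofScalars] using this

/-- A Schur test for convolution operators on a weighted `ℓ²` space. -/
lemma weighted_convolution_bound {b : ℕ → ℝ} (hb : ∀ n, 0 < b n) {c α : ℕ → ℂ} {C : ℝ}
    (hc : Summable fun n => ‖c n‖)
    (hC : ∀ n, ∑ k ∈ Finset.range (n + 1), b k * ‖c (n - k)‖ ≤ C * b n)
    (hα : Summable fun n => ‖α n‖ ^ 2 / b n) :
    Summable (fun n => ‖∑ k ∈ Finset.range (n + 1), α k * c (n - k)‖ ^ 2 / b n) ∧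
      ∑' n, ‖∑ k ∈ Finset.range (n + 1), α k * c (n - k)‖ ^ 2 / b n ≤
        C * ((∑' n, ‖α n‖ ^ 2 / b n) * ∑' n, ‖c n‖) := by
  have hsum := hasSum_sum_range_mul_of_summable_norm hα.norm hc.norm
  have hle : ∀ n, ‖∑ k ∈ Finset.range (n + 1), α k * c (n - k)‖ ^ 2 / b n ≤
      C * ∑ k ∈ Finset.range (n + 1), ‖α k‖ ^ 2 / b k * ‖c (n - k)‖ := by
    intro n
    have hnonneg : 0 ≤ ∑ k ∈ Finset.range (n + 1), ‖α k‖ ^ 2 / b k * ‖c (n - k)‖ :=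
      Finset.sum_nonneg fun k _ =>
        mul_nonneg (div_nonneg (sq_nonneg _) (hb k).le) (norm_nonneg _)
    rw [div_le_iff₀ (hb n)]
    calc ‖∑ k ∈ Finset.range (n + 1), α k * c (n - k)‖ ^ 2
        ≤ (∑ k ∈ Finset.range (n + 1), ‖α k‖ * ‖c (n - k)‖) ^ 2 := by
          gcongr
          exact (norm_sum_le _ _).trans_eq (by simp only [norm_mul])
      _ ≤ (∑ k ∈ Finset.range (n + 1), b k * ‖c (n - k)‖) *
            ∑ k ∈ Finset.range (n + 1), ‖α k‖ ^ 2 / b k * ‖c (n - k)‖ := by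
          refine Finset.sum_sq_le_sum_mul_sum_of_sq_le_mul _
            (fun k _ => mul_nonneg (hb k).le (norm_nonneg _))
            (fun k _ => mul_nonneg (div_nonneg (sq_nonneg _) (hb k).le) (norm_nonneg _))
            (fun k _ => le_of_eq ?_)
          have := (hb k).ne'
          field_simp
      _ ≤ C * b n * ∑ k ∈ Finset.range (n + 1), ‖α k‖ ^ 2 / b k * ‖c (n - k)‖ := by
          gcongr
          exact hC n
      _ = _ := by ring
  have hnn : ∀ n, 0 ≤ ‖∑ k ∈ Finset.range (n + 1), α k * c (n - k)‖ ^ 2 / b n :=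
    fun n => div_nonneg (sq_nonneg _) (hb n).le
  have hS := (hsum.mul_left C)
  have hsummable := Summable.of_nonneg_of_le hnn hle hS.summable
  exact ⟨hsummable, (hsummable.tsum_le_tsum hle hS.summable).trans_eq hS.tsum_eq⟩

lemma sum_range_rpow_le {γ : ℝ} (hγ : -1 < γ) (hγ' : γ ≤ 0) (n : ℕ) :
    ∑ k ∈ Finset.range n, ((k : ℝ) + 1) ^ γ ≤ (n : ℝ) ^ (γ + 1) / (γ + 1) := by
  have hp : 0 < γ + 1 := by linarith
  rw [le_div_iff₀ hp]
  induction n with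
  | zero => simp [Real.zero_rpow hp.ne']
  | succ n ih =>
    rw [Finset.sum_range_succ, add_mul]
    have hn : (0 : ℝ) < n + 1 := by positivity
    have hinv : (1 : ℝ) / (n + 1) ≤ 1 := by
      rw [div_le_one hn]
      linarith [n.cast_nonneg (α := ℝ)]
    have hbern := rpow_one_add_le_one_add_mul_self (s := -(1 / ((n : ℝ) + 1)))
      (by linarith) hp.le (by linarith : γ + 1 ≤ 1)
    have hquot : 1 + -(1 / ((n : ℝ) + 1)) = n / (n + 1) := by
      field_simp
      ring
    rw [hquot, Real.div_rpow n.cast_nonneg hn.le, div_le_iff₀ (by positivity),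
      Real.rpow_add_one hn.ne'] at hbern
    have : (1 + (γ + 1) * -(1 / ((n : ℝ) + 1))) * (((n : ℝ) + 1) ^ γ * (n + 1)) =
        ((n : ℝ) + 1) ^ γ * (n + 1) - ((n : ℝ) + 1) ^ γ * (γ + 1) := by
      field_simp
      ring
    push_cast
    rw [Real.rpow_add_one hn.ne']
    linarith

lemma geometric_convolution_one_le {r : ℝ} (hr : 0 ≤ r) (hr' : r < 1) (n : ℕ) :
    (1 - r ^ 2) * ∑ k ∈ Finset.range n, r ^ (n - 1 - k) ≤ 2 := by
  rw [Finset.sum_range_reflect (fun j => r ^ j) n]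
  have h := mul_neg_geom_sum r n
  have hpow : 0 ≤ r ^ n := pow_nonneg hr n
  calc (1 - r ^ 2) * ∑ k ∈ Finset.range n, r ^ k
      = (1 + r) * ((1 - r) * ∑ k ∈ Finset.range n, r ^ k) := by ring
    _ = (1 + r) * (1 - r ^ n) := by rw [h]
    _ ≤ 2 := by nlinarith

lemma geometric_convolution_rpow_le {γ : ℝ} (hγ : -1 < γ) :
    ∃ C : ℝ, 0 < C ∧ ∀ r : ℝ, 0 ≤ r → r < 1 → ∀ n : ℕ,
      (1 - r ^ 2) * ∑ k ∈ Finset.range n, ((k : ℝ) + 1) ^ γ * r ^ (n - 1 - k) ≤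
        C * ((n : ℝ) + 1) ^ γ := by
  rcases le_total 0 γ with hγ0 | hγ0
  · refine ⟨2, two_pos, fun r hr hr' n => ?_⟩
    have hr2 : 0 ≤ 1 - r ^ 2 := by nlinarith
    calc (1 - r ^ 2) * ∑ k ∈ Finset.range n, ((k : ℝ) + 1) ^ γ * r ^ (n - 1 - k)
        ≤ (1 - r ^ 2) * ∑ k ∈ Finset.range n, ((n : ℝ) + 1) ^ γ * r ^ (n - 1 - k) := by
          gcongr with k hk
          exact (Finset.mem_range.mp hk).le
      _ = ((1 - r ^ 2) * ∑ k ∈ Finset.range n, r ^ (n - 1 - k)) * ((n : ℝ) + 1) ^ γ := by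
          rw [← Finset.mul_sum]
          ring
      _ ≤ 2 * ((n : ℝ) + 1) ^ γ := by
          gcongr
          exact geometric_convolution_one_le hr hr' n
  · have hp : 0 < γ + 1 := by linarith
    refine ⟨2 * (2 ^ (-γ) / (γ + 1)), by positivity, fun r hr hr' n => ?_⟩
    have hr2 : 0 ≤ 1 - r ^ 2 := by nlinarith
    rcases Nat.eq_zero_or_pos n with rfl | hn
    · simp only [Finset.range_zero, Finset.sum_empty, mul_zero]
      positivity
    have hn0 : (0 : ℝ) < n := by exact_mod_cast hn
    have hn1 : (1 : ℝ) ≤ n := by exact_mod_cast hn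
    have hanti : AntivaryOn (fun k : ℕ => ((k : ℝ) + 1) ^ γ) (fun k => r ^ (n - 1 - k))
        (Finset.range n : Set ℕ) := by
      refine AntitoneOn.antivaryOn (s := (Finset.range n : Set ℕ)) ?_ ?_
      · intro i _ j _ hij
        exact Real.rpow_le_rpow_of_nonpos (by positivity) (by gcongr) hγ0
      · intro i _ j _ hij
        exact pow_le_pow_of_le_one hr hr'.le (by omega)
    have hcheb := hanti.card_mul_sum_le_sum_mul_sum
    rw [Finset.card_range] at hcheb
    have hpow : (n : ℝ) ^ γ ≤ 2 ^ (-γ) * ((n : ℝ) + 1) ^ γ := by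
      have h2 : (2 : ℝ) ^ (-γ) * ((n : ℝ) + 1) ^ γ = (((n : ℝ) + 1) / 2) ^ γ := by
        rw [Real.div_rpow (by positivity) two_pos.le, Real.rpow_neg two_pos.le]
        ring
      rw [h2]
      exact Real.rpow_le_rpow_of_nonpos (by positivity) (by linarith) hγ0
    refine le_of_mul_le_mul_left ?_ hn0
    calc (n : ℝ) * ((1 - r ^ 2) * ∑ k ∈ Finset.range n, ((k : ℝ) + 1) ^ γ * r ^ (n - 1 - k))
        = (1 - r ^ 2) *
            (n * ∑ k ∈ Finset.range n, ((k : ℝ) + 1) ^ γ * r ^ (n - 1 - k)) := by ring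
      _ ≤ (1 - r ^ 2) * ((∑ k ∈ Finset.range n, ((k : ℝ) + 1) ^ γ) *
            ∑ k ∈ Finset.range n, r ^ (n - 1 - k)) := by gcongr
      _ = ((1 - r ^ 2) * ∑ k ∈ Finset.range n, r ^ (n - 1 - k)) *
            ∑ k ∈ Finset.range n, ((k : ℝ) + 1) ^ γ := by ring
      _ ≤ 2 * ((n : ℝ) ^ (γ + 1) / (γ + 1)) := by
          gcongr
          · exact geometric_convolution_one_le hr hr' n
          · exact sum_range_rpow_le hγ hγ0 n
      _ = 2 * n / (γ + 1) * (n : ℝ) ^ γ := by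
          rw [Real.rpow_add_one hn0.ne']
          ring
      _ ≤ 2 * n / (γ + 1) * (2 ^ (-γ) * ((n : ℝ) + 1) ^ γ) := by gcongr
      _ = _ := by ring

lemma mobiusBounded_of_neg_one_lt {γ : ℝ} (hγ : -1 < γ) {b : ℕ → ℝ} (hb : ∀ n, 0 < b n)
    {c₁ c₂ : ℝ} (hc₁ : 0 < c₁) (hc₂ : 0 < c₂)
    (hgrowth : ∀ n : ℕ, c₁ * ((n : ℝ) + 1) ^ γ ≤ b n ∧ b n ≤ c₂ * ((n : ℝ) + 1) ^ γ) :
    MobiusBounded b := by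
  obtain ⟨C, hC, hconv⟩ := geometric_convolution_rpow_le hγ
  set D : ℝ := c₂ * C / c₁ + 1 with hD
  have hDpos : 0 < D := by positivity
  refine ⟨√(D * 3), by positivity, fun θ _ a ha f α hf hα => ?_⟩
  rw [mem_ball_zero_iff] at ha
  have hschur : ∀ n, ∑ k ∈ Finset.range (n + 1), b k * ‖mobiusCoeff θ a (n - k)‖ ≤ D * b n := by
    intro n
    have hr2 : 0 ≤ 1 - ‖a‖ ^ 2 := by nlinarith [norm_nonneg a]
    rw [Finset.sum_range_succ, Nat.sub_self, norm_mobiusCoeff_zero, hD, add_mul, one_mul]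
    refine add_le_add ?_ (mul_le_of_le_one_right (hb n).le ha.le)
    calc ∑ k ∈ Finset.range n, b k * ‖mobiusCoeff θ a (n - k)‖
        ≤ ∑ k ∈ Finset.range n,
            c₂ * ((k : ℝ) + 1) ^ γ * ((1 - ‖a‖ ^ 2) * ‖a‖ ^ (n - 1 - k)) := by
          refine Finset.sum_le_sum fun k hk => ?_
          have hk' : n - k = n - 1 - k + 1 := by
            have := Finset.mem_range.mp hk
            omega
          rw [hk', norm_mobiusCoeff_succ θ ha]
          gcongr
          exact (hgrowth k).2
      _ = c₂ * ((1 - ‖a‖ ^ 2) *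
            ∑ k ∈ Finset.range n, ((k : ℝ) + 1) ^ γ * ‖a‖ ^ (n - 1 - k)) := by
          rw [Finset.mul_sum, Finset.mul_sum]
          exact Finset.sum_congr rfl fun k _ => by ring
      _ ≤ c₂ * (C * ((n : ℝ) + 1) ^ γ) := by
          exact mul_le_mul_of_nonneg_left (hconv _ (norm_nonneg a) ha n) hc₂.le
      _ = c₂ * C / c₁ * (c₁ * ((n : ℝ) + 1) ^ γ) := by field_simp
      _ ≤ c₂ * C / c₁ * b n := by
          gcongr
          exact (hgrowth n).1
  have hcoeff := hasSum_norm_mobiusCoeff θ ha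
  obtain ⟨hs, hle⟩ := weighted_convolution_bound hb hcoeff.summable hschur hα
  refine ⟨_, fun z hz => hasSum_mobius_mul θ ha (mem_ball_zero_iff.mp hz) (hf z hz), hs,
    hle.trans ?_⟩
  rw [hcoeff.tsum_eq, Real.sq_sqrt (by positivity), mul_assoc,
    mul_comm (∑' n, ‖α n‖ ^ 2 / b n)]
  have : 0 ≤ ∑' n, ‖α n‖ ^ 2 / b n := tsum_nonneg fun n => div_nonneg (sq_nonneg _) (hb n).le
  gcongr
  linarith

lemma MobiusBounded.neg_one_lt {γ : ℝ} {b : ℕ → ℝ} (hb : ∀ n, 0 < b n)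
    {c₁ c₂ : ℝ} (hc₁ : 0 < c₁) (hc₂ : 0 < c₂)
    (hgrowth : ∀ n : ℕ, c₁ * ((n : ℝ) + 1) ^ γ ≤ b n ∧ b n ≤ c₂ * ((n : ℝ) + 1) ^ γ)
    (h : MobiusBounded b) : -1 < γ := by
  by_contra! hγ
  obtain ⟨c, hc, h⟩ := h
  have hbound : ∀ K : ℕ, 0 < K →
      ∑ k ∈ Finset.range K, (1 / ((k : ℝ) + 1)) ≤ 64 * c₂ * c ^ 2 / c₁ := by
    intro K hK
    have hK0 : (0 : ℝ) < K := by exact_mod_cast hK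
    have hK1 : (1 : ℝ) ≤ K := by exact_mod_cast hK
    set S : ℝ := ∑ k ∈ Finset.range K, ((k : ℝ) + 1) ^ γ with hS
    have hSpos : 0 < S := Finset.sum_pos (fun k _ => by positivity) ⟨0, by simpa using hK⟩
    set r : ℝ := 1 + -(1 / (4 * K)) with hr
    have hinv : 1 / (4 * (K : ℝ)) ≤ 1 / 4 := by
      gcongr
      linarith
    have hinv0 : 0 < 1 / (4 * (K : ℝ)) := by positivity
    have hr0 : 0 < r := by linarith
    have hr1 : r < 1 := by linarith
    have hnorm : ‖(r : ℂ)‖ = r := by rw [Complex.norm_real, Real.norm_of_nonneg hr0.le]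
    have hrball : ‖(r : ℂ)‖ < 1 := by rwa [hnorm]
    have hrpow : 1 / 2 ≤ r ^ (2 * K) := by
      have := one_add_mul_le_pow (a := -(1 / (4 * (K : ℝ)))) (by linarith) (2 * K)
      refine le_trans (le_of_eq ?_) this
      push_cast
      field_simp
      norm_num
    let α : ℕ → ℂ := fun k => if k < K then (((k : ℝ) + 1) ^ γ : ℝ) else 0
    have hα_lt : ∀ k, k < K → α k = (((k : ℝ) + 1) ^ γ : ℝ) := fun k hk => if_pos hk
    have hα_ge : ∀ k, k ∉ Finset.range K → α k = 0 := fun k hk => if_neg (by simpa using hk)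
    have hnormsum : HasSum (fun n => ‖α n‖ ^ 2 / b n)
        (∑ n ∈ Finset.range K, ‖α n‖ ^ 2 / b n) :=
      hasSum_sum_of_ne_finset_zero fun k hk => by simp [hα_ge k hk]
    obtain ⟨β, hβ, hβs, hβle⟩ := h 0 ⟨le_rfl, by positivity⟩ r (mem_ball_zero_iff.mpr hrball)
      (fun z => ∑ n ∈ Finset.range K, α n * z ^ n) α
      (fun z _ => hasSum_sum_of_ne_finset_zero fun k hk => by simp [hα_ge k hk])
      hnormsum.summable
    have hβeq : β = fun n => ∑ k ∈ Finset.range (n + 1), α k * mobiusCoeff 0 r (n - k) :=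
      coeff_unique hβ fun z hz => hasSum_mobius_mul 0 hrball (mem_ball_zero_iff.mp hz)
        (hasSum_sum_of_ne_finset_zero fun k hk => by simp [hα_ge k hk])
    have hupper : ∑ n ∈ Finset.range K, ‖α n‖ ^ 2 / b n ≤ S / c₁ := by
      rw [hS, Finset.sum_div]
      refine Finset.sum_le_sum fun k hk => ?_
      have hpos : 0 < ((k : ℝ) + 1) ^ γ := by positivity
      rw [hα_lt k (Finset.mem_range.mp hk), Complex.norm_real, Real.norm_of_nonneg hpos.le,
        div_le_div_iff₀ (hb k) hc₁]
      nlinarith [(hgrowth k).1]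
    have hβlower : ∀ n ∈ Finset.Ico K (2 * K), S / (8 * K) ≤ ‖β n‖ := by
      intro n hn
      obtain ⟨hKn, hn2⟩ := Finset.mem_Ico.mp hn
      have hval : β n =
          ((∑ k ∈ Finset.range K, ((k : ℝ) + 1) ^ γ * ((1 - r ^ 2) * r ^ (n - 1 - k)) : ℝ) : ℂ) := by
        rw [hβeq]
        push_cast
        rw [← Finset.sum_subset (Finset.range_mono (by omega : K ≤ n + 1))
          fun k _ hk => by rw [hα_ge k hk, zero_mul]]
        refine Finset.sum_congr rfl fun k hk => ?_
        have hk' := Finset.mem_range.mp hk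
        have hnk : n - k = n - 1 - k + 1 := by omega
        rw [hα_lt k hk', hnk]
        simp [mobiusCoeff, Complex.conj_ofReal]
      rw [hval, Complex.norm_real]
      refine le_trans ?_ (le_abs_self _)
      rw [hS, Finset.sum_div]
      refine Finset.sum_le_sum fun k _ => ?_
      have hr2 : 1 / (4 * (K : ℝ)) ≤ 1 - r ^ 2 := by nlinarith
      have hpow : 1 / 2 ≤ r ^ (n - 1 - k) :=
        hrpow.trans (pow_le_pow_of_le_one hr0.le hr1.le (by omega))
      calc ((k : ℝ) + 1) ^ γ / (8 * K)
          = ((k : ℝ) + 1) ^ γ * (1 / (4 * K) * (1 / 2)) := by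
            field_simp
            norm_num
        _ ≤ _ := by
            have := hinv0.le.trans hr2
            gcongr
    have hlower : K * ((S / (8 * K)) ^ 2 / (c₂ * (K : ℝ) ^ γ)) ≤ ∑' n, ‖β n‖ ^ 2 / b n := by
      refine le_trans ?_ (hβs.sum_le_tsum (Finset.Ico K (2 * K))
        fun n _ => div_nonneg (sq_nonneg _) (hb n).le)
      have hcard : (Finset.Ico K (2 * K)).card = K := by
        rw [Nat.card_Ico]
        omega
      have := Finset.card_nsmul_le_sum (Finset.Ico K (2 * K)) (fun n => ‖β n‖ ^ 2 / b n)
        ((S / (8 * K)) ^ 2 / (c₂ * (K : ℝ) ^ γ)) fun n hn => by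
          have hbn : b n ≤ c₂ * (K : ℝ) ^ γ := by
            refine (hgrowth n).2.trans ?_
            gcongr ?_ * ?_
            refine Real.rpow_le_rpow_of_nonpos hK0 ?_ (by linarith)
            have : (K : ℝ) ≤ n := by exact_mod_cast (Finset.mem_Ico.mp hn).1
            linarith
          have := hβlower n hn
          have := hb n
          gcongr
      rwa [hcard, nsmul_eq_mul] at this
    rw [hnormsum.tsum_eq] at hβle
    have hmain : K * ((S / (8 * K)) ^ 2 / (c₂ * (K : ℝ) ^ γ)) ≤ c ^ 2 * (S / c₁) :=
      hlower.trans (hβle.trans (by gcongr))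
    have hKγ : 0 < (K : ℝ) ^ γ := by positivity
    have hratio : S / (K * (K : ℝ) ^ γ) ≤ 64 * c₂ * c ^ 2 / c₁ := by
      have h1 : K * ((S / (8 * K)) ^ 2 / (c₂ * (K : ℝ) ^ γ)) =
          S / (K * (K : ℝ) ^ γ) * (S / (64 * c₂)) := by
        field_simp
        norm_num
      have h2 : c ^ 2 * (S / c₁) = 64 * c₂ * c ^ 2 / c₁ * (S / (64 * c₂)) := by
        field_simp
      rw [h1, h2] at hmain
      exact le_of_mul_le_mul_right hmain (by positivity)
    refine le_trans ?_ hratio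
    rw [hS, Finset.sum_div]
    refine Finset.sum_le_sum fun k hk => ?_
    have hkK : (k : ℝ) + 1 ≤ K := by exact_mod_cast Finset.mem_range.mp hk
    have hk0 : (0 : ℝ) < (k : ℝ) + 1 := by positivity
    have hmono : (K : ℝ) ^ (γ + 1) ≤ ((k : ℝ) + 1) ^ (γ + 1) :=
      Real.rpow_le_rpow_of_nonpos hk0 hkK (by linarith)
    rw [Real.rpow_add_one hK0.ne', Real.rpow_add_one hk0.ne'] at hmono
    rw [div_le_div_iff₀ hk0 (by positivity)]
    linarith
  obtain ⟨K, hK, hK0⟩ := ((Real.tendsto_sum_range_one_div_nat_succ_atTop.eventually_gt_atTop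
    (64 * c₂ * c ^ 2 / c₁)).and (Filter.eventually_gt_atTop 0)).exists
  exact absurd (hbound K hK0) (not_le.mpr hK)

/-- Let `γ ∈ ℝ` and `(bₙ)` be positive reals with
`c₁ (n+1)^γ ≤ bₙ ≤ c₂ (n+1)^γ`. Then `M_z` on `H(b)` is Möbius bounded iff `γ > −1`. -/
theorem stmt_11 (γ : ℝ) (b : ℕ → ℝ) (hb : ∀ n, 0 < b n)
    (hgrowth : ∃ c₁ c₂ : ℝ, 0 < c₁ ∧ 0 < c₂ ∧ ∀ n : ℕ,
      c₁ * ((n : ℝ) + 1) ^ γ ≤ b n ∧ b n ≤ c₂ * ((n : ℝ) + 1) ^ γ) :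
    MobiusBounded b ↔ -1 < γ := by
  obtain ⟨c₁, c₂, hc₁, hc₂, hgrowth⟩ := hgrowth
  exact ⟨fun h => h.neg_one_lt hb hc₁ hc₂ hgrowth,
    fun h => mobiusBounded_of_neg_one_lt h hb hc₁ hc₂ hgrowth⟩
end

section
/- Let 0 < λ ≤ μ and let ψ be a holomorphic function on 𝔻 which is not identically zero. For a ∈ 𝔻 let k_a(w) = (1−|a|²)/(1−ā w)² for w ∈ 𝔻 (so that k_a = e^{−iθ} φ_{θ,a}′). Suppose there exists a constant c > 0 such that for every a ∈ 𝔻 and every f ∈ H^{(λ)}, the function ψ·k_a·f belongs to H^{(μ)} with ‖ψ k_a f‖_{H^{(μ)}} ≤ c ‖f‖_{H^{(λ)}}. Then μ − λ ≥ 2. -/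
open Metric

/-- The Pochhammer symbol `(l)ₙ = l (l+1) ⋯ (l+n−1)`. -/
noncomputable def poch (l : ℝ) (n : ℕ) : ℝ := ∏ i ∈ Finset.range n, (l + i)

/-- The weight `n! / (l)ₙ`, i.e. `‖zⁿ‖²` in the space `H^{(l)}` with kernel `(1 - z w̄)^{-l}`. -/
noncomputable def wt (l : ℝ) (n : ℕ) : ℝ := (Nat.factorial n : ℝ) / poch l n

/-- The normalized derivative of a Möbius transformation:
`k_a(w) = (1 − |a|²)/(1 − ā w)²`, so that `k_a = e^{−iθ} φ_{θ,a}′`. -/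
noncomputable def kern (a w : ℂ) : ℂ :=
  ((1 - ‖a‖ ^ 2 : ℝ) : ℂ) / (1 - (starRingEnd ℂ) a * w) ^ 2

theorem poch_eq_ascPochhammer_eval (l : ℝ) (n : ℕ) : poch l n = (ascPochhammer ℝ n).eval l := by
  induction n with
  | zero => simp [poch]
  | succ n ih => rw [ascPochhammer_succ_eval, ← ih, poch, poch, Finset.prod_range_succ]

theorem inv_wt_eq_choose (l : ℝ) (n : ℕ) : (wt l n)⁻¹ = Ring.choose (l + n - 1) n := by
  have hfac : (n.factorial : ℝ) ≠ 0 := by positivity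
  have h1 := Ring.factorial_nsmul_multichoose_eq_ascPochhammer l n
  rw [Polynomial.ascPochhammer_smeval_eq_eval, ← poch_eq_ascPochhammer_eval, nsmul_eq_mul] at h1
  rw [wt, inv_div, ← h1, Ring.choose, mul_div_cancel_left₀ _ hfac]
  congr 1
  ring

theorem wt_pos {l : ℝ} (hl : 0 < l) (n : ℕ) : 0 < wt l n :=
  div_pos (by positivity) (Finset.prod_pos fun i _ => by positivity)

theorem hasSum_inv_wt_mul_pow (l : ℝ) {x : ℝ} (hx : |x| < 1) :
    HasSum (fun n => (wt l n)⁻¹ * x ^ n) (1 / (1 - x) ^ l) := by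
  have h := (Real.one_div_one_sub_rpow_hasFPowerSeriesOnBall_zero l).hasSum (y := x)
    (by simpa [enorm_eq_nnnorm, ← NNReal.coe_lt_coe] using hx)
  simpa [FormalMultilinearSeries.ofScalars, inv_wt_eq_choose, mul_comm] using h

/-- The point evaluation estimate `|g(z)|² ≤ ‖g‖² (1 - |z|²)^{-m}` in `H^{(m)}`. -/
theorem norm_sq_le_of_hasSum {m : ℝ} (hm : 0 < m) {β : ℕ → ℂ} {z S : ℂ} (hz : ‖z‖ < 1)
    (hS : HasSum (fun n => β n * z ^ n) S) (hβ : Summable fun n => ‖β n‖ ^ 2 * wt m n) :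
    ‖S‖ ^ 2 ≤ (∑' n, ‖β n‖ ^ 2 * wt m n) * (1 / (1 - ‖z‖ ^ 2) ^ m) := by
  have hx : |‖z‖ ^ 2| < 1 := by
    rw [abs_of_nonneg (by positivity)]
    exact pow_lt_one₀ (norm_nonneg z) hz two_ne_zero
  have hK := hasSum_inv_wt_mul_pow m hx
  refine le_of_tendsto_of_tendsto' (hS.norm.pow 2) (Filter.Tendsto.mul hβ.hasSum hK) fun s => ?_
  refine (pow_le_pow_left₀ (norm_nonneg _) (norm_sum_le _ _) 2).trans ?_
  refine Finset.sum_sq_le_sum_mul_sum_of_sq_le_mul s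
    (fun n _ => by have := wt_pos hm n; positivity) (fun n _ => by have := wt_pos hm n; positivity)
    fun n _ => le_of_eq ?_
  have := (wt_pos hm n).ne'
  rw [norm_mul, norm_pow]
  field_simp
  ring

/-- A function on the unit disc whose modulus is dominated by a radial function tending to zero
at the boundary vanishes identically. -/
theorem eq_zero_of_norm_sq_le_radial {ψ : ℂ → ℂ} (hψ : DifferentiableOn ℂ ψ (ball 0 1))
    {B : ℝ → ℝ} (hB : Filter.Tendsto B (nhdsWithin 1 (Set.Iio 1)) (nhds 0))
    (h : ∀ w ∈ ball (0 : ℂ) 1, ‖ψ w‖ ^ 2 ≤ B ‖w‖) {z : ℂ} (hz : z ∈ ball (0 : ℂ) 1) :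
    ψ z = 0 := by
  rw [mem_ball_zero_iff] at hz
  have key : ∀ᶠ r in nhdsWithin (1 : ℝ) (Set.Iio 1), ‖ψ z‖ ^ 2 ≤ B r := by
    filter_upwards [Ioo_mem_nhdsLT hz] with r hr
    have hr0 : 0 < r := (norm_nonneg z).trans_lt hr.1
    have hd : DiffContOnCl ℂ ψ (ball 0 r) := by
      refine DifferentiableOn.diffContOnCl (hψ.mono ?_)
      rw [closure_ball _ hr0.ne']
      exact closedBall_subset_ball hr.2
    have hC : ∀ w ∈ frontier (ball (0 : ℂ) r), ‖ψ w‖ ≤ √(B r) := by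
      intro w hw
      rw [frontier_ball _ hr0.ne', mem_sphere_zero_iff_norm] at hw
      refine Real.le_sqrt_of_sq_le ?_
      simpa [hw] using h w (by simpa [hw] using hr.2)
    have hzr := Complex.norm_le_of_forall_mem_frontier_norm_le isBounded_ball hd hC
      (subset_closure (by simpa using hr.1 : z ∈ ball (0 : ℂ) r))
    have hBr : 0 ≤ B r := by
      have hn : ‖(r : ℂ)‖ = r := by simp [abs_of_pos hr0]
      have := h r (by simpa [abs_of_pos hr0] using hr.2)
      rw [hn] at this
      exact (sq_nonneg _).trans this
    calc ‖ψ z‖ ^ 2 ≤ √(B r) ^ 2 := pow_le_pow_left₀ (norm_nonneg _) hzr 2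
      _ = B r := Real.sq_sqrt hBr
  have h0 : ‖ψ z‖ ^ 2 ≤ 0 := ge_of_tendsto hB key
  simpa using le_antisymm h0 (sq_nonneg _)

/-- Let `0 < λ ≤ μ` and let `ψ` be holomorphic on the unit disc and not
identically zero. If there is `c > 0` such that for every `a ∈ 𝔻` and `f ∈ H^{(λ)}` the function
`ψ k_a f` belongs to `H^{(μ)}` with `‖ψ k_a f‖_{H^{(μ)}} ≤ c ‖f‖_{H^{(λ)}}`, then `μ − λ ≥ 2`. -/
theorem stmt_15 (l m : ℝ) (hl : 0 < l) (hlm : l ≤ m)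
    (ψ : ℂ → ℂ) (hψhol : DifferentiableOn ℂ ψ (ball 0 1))
    (hψne : ∃ z ∈ ball (0 : ℂ) 1, ψ z ≠ 0)
    (c : ℝ) (hc : 0 < c)
    (hbd : ∀ a ∈ ball (0 : ℂ) 1, ∀ (f : ℂ → ℂ) (α : ℕ → ℂ),
      (∀ z ∈ ball (0 : ℂ) 1, HasSum (fun n => α n * z ^ n) (f z)) →
      Summable (fun n => ‖α n‖ ^ 2 * wt l n) →
      ∃ β : ℕ → ℂ,
        (∀ z ∈ ball (0 : ℂ) 1, HasSum (fun n => β n * z ^ n) (ψ z * kern a z * f z)) ∧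
        Summable (fun n => ‖β n‖ ^ 2 * wt m n) ∧
        ∑' n, ‖β n‖ ^ 2 * wt m n ≤ c ^ 2 * ∑' n, ‖α n‖ ^ 2 * wt l n) :
    2 ≤ m - l := by
  by_contra! hlt
  obtain ⟨z, hz, hne⟩ := hψne
  refine hne (eq_zero_of_norm_sq_le_radial hψhol
    (B := fun r => c ^ 2 * (1 - r ^ 2) ^ (2 - (m - l))) ?_ ?_ hz)
  · have h1 : ContinuousAt (fun r : ℝ => c ^ 2 * (1 - r ^ 2) ^ (2 - (m - l))) 1 :=
      continuousAt_const.mul (ContinuousAt.rpow_const (by fun_prop) (Or.inr (by linarith)))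
    have h2 := h1.tendsto
    simp only [one_pow, sub_self, Real.zero_rpow (by linarith : 2 - (m - l) ≠ 0), mul_zero] at h2
    exact h2.mono_left nhdsWithin_le_nhds
  intro w hw
  have hw1 : ‖w‖ < 1 := by simpa using hw
  have hx : |‖w‖ ^ 2| < 1 := by
    rw [abs_of_nonneg (by positivity)]
    exact pow_lt_one₀ (norm_nonneg w) hw1 two_ne_zero
  have ht : 0 < 1 - ‖w‖ ^ 2 := by linarith [le_abs_self (‖w‖ ^ 2)]
  have hK := hasSum_inv_wt_mul_pow l hx
  let α : ℕ → ℂ := fun n => ((wt l n)⁻¹ : ℝ) * (starRingEnd ℂ) w ^ n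
  have hα : HasSum (fun n => ‖α n‖ ^ 2 * wt l n) (1 / (1 - ‖w‖ ^ 2) ^ l) := by
    convert hK using 2 with n
    have := wt_pos hl n
    simp only [α, norm_mul, norm_pow, Complex.norm_real, RCLike.norm_conj, Real.norm_eq_abs,
      abs_of_pos (inv_pos.mpr this)]
    field_simp
    ring
  have hfw : HasSum (fun n => α n * w ^ n) ((1 / (1 - ‖w‖ ^ 2) ^ l : ℝ) : ℂ) := by
    convert Complex.hasSum_ofReal.mpr hK using 2 with n
    simp only [α]
    rw [mul_assoc, ← mul_pow, Complex.conj_mul']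
    push_cast
    rfl
  obtain ⟨β, hβ, hβs, hβle⟩ := hbd w hw (fun z => ∑' n, α n * z ^ n) α (fun z hz => by
    have hz1 : ‖z‖ < 1 := by simpa using hz
    refine (Summable.of_norm ?_).hasSum
    have hzw : |‖w‖ * ‖z‖| < 1 := by
      rw [abs_of_nonneg (by positivity)]
      exact mul_lt_one_of_nonneg_of_lt_one_left (norm_nonneg _) hw1 hz1.le
    refine (hasSum_inv_wt_mul_pow l hzw).summable.congr fun n => ?_
    simp only [α, norm_mul, norm_pow, Complex.norm_real, RCLike.norm_conj, Real.norm_eq_abs,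
      abs_of_pos (inv_pos.mpr (wt_pos hl n))]
    ring) hα.summable
  have hev := norm_sq_le_of_hasSum (hl.trans_le hlm) hw1 (hβ w hw) hβs
  rw [hfw.tsum_eq] at hev
  rw [hα.tsum_eq] at hβle
  have hkern : kern w w = (((1 - ‖w‖ ^ 2)⁻¹ : ℝ) : ℂ) := by
    rw [kern, Complex.conj_mul']
    have : (1 - (‖w‖ : ℂ) ^ 2) ≠ 0 := by exact_mod_cast ht.ne'
    push_cast
    field_simp
  generalize 1 - ‖w‖ ^ 2 = t at *
  have hl' : 0 < t ^ l := Real.rpow_pos_of_pos ht l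
  have hm' : 0 < t ^ m := Real.rpow_pos_of_pos ht m
  have hev := hev.trans (mul_le_mul_of_nonneg_right hβle (by positivity))
  rw [hkern, norm_mul, norm_mul, Complex.norm_real, Complex.norm_real, Real.norm_of_nonneg
    (by positivity), Real.norm_of_nonneg (by positivity)] at hev
  have hpow : t ^ (2 - (m - l)) = t ^ 2 * t ^ l / t ^ m := by
    rw [show 2 - (m - l) = 2 + l - m by ring, Real.rpow_sub ht, Real.rpow_add ht, Real.rpow_two]
  simp only [hpow]
  calc ‖ψ w‖ ^ 2 = (‖ψ w‖ * t⁻¹ * (1 / t ^ l)) ^ 2 * (t ^ 2 * (t ^ l) ^ 2) := by field_simp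
    _ ≤ c ^ 2 * (1 / t ^ l) * (1 / t ^ m) * (t ^ 2 * (t ^ l) ^ 2) := by gcongr
    _ = c ^ 2 * (t ^ 2 * t ^ l / t ^ m) := by field_simp
end
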